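/- For a local good semigroup S ⊆ ℕ² with conductor c(S) = (c₁,c₂), define T(S) = BT(S) if c₂ = 1, and T(S) = {T((α₁,…,α_n)) ∈ BT(S) : the ending point α_n satisfies α_n ≥ (∞,c₂), i.e. α_n = (∞,b) with b ≥ c₂} if c₂ ≠ 1. Then every local good semigroup S' ⊆ ℕ² with S' ≠ ℕ²(1,1) has one and only one special parent S such that S' = S∖T with T ∈ T(S). -/

import Mathlib

/-- The ambient space `ℤ²`; `ℕ²` is identified with the nonnegative orthant. -/
abbrev Z2 : Type := ℤ × ℤ

/-- The nonnegative orthant, representing `ℕ² ⊆ ℤ²`. -/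
def orth : Set Z2 := {a : Z2 | 0 ≤ a.1 ∧ 0 ≤ a.2}

/-- Property (G1): closure under componentwise minimum. -/
def MinClosed (E : Set Z2) : Prop := ∀ a ∈ E, ∀ b ∈ E, a ⊓ b ∈ E

/-- Property (G3). -/
def G3P (E : Set Z2) : Prop :=
  ∀ a ∈ E, ∀ b ∈ E, a ≠ b →
    (a.1 = b.1 →
      ∃ e ∈ E, a.1 < e.1 ∧ min a.2 b.2 ≤ e.2 ∧ (a.2 ≠ b.2 → e.2 = min a.2 b.2)) ∧
    (a.2 = b.2 →
      ∃ e ∈ E, a.2 < e.2 ∧ min a.1 b.1 ≤ e.1 ∧ (a.1 ≠ b.1 → e.1 = min a.1 b.1))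

/-- A good semigroup of `ℕ²` (viewed inside `ℤ²`). -/
def IsGood (S : Set Z2) : Prop :=
  S ⊆ orth ∧ (0 : Z2) ∈ S ∧ (∀ a ∈ S, ∀ b ∈ S, a + b ∈ S) ∧
  MinClosed S ∧ (∃ δ : Z2, ∀ y : Z2, δ ≤ y → y ∈ S) ∧ G3P S

/-- A good semigroup is local if its only element with a zero coordinate is `0`. -/
def IsLocal (S : Set Z2) : Prop := ∀ a ∈ S, (a.1 = 0 ∨ a.2 = 0) → a = 0

/-- A relative good ideal of `S`. -/
def IsRelGoodIdeal (S E : Set Z2) : Prop :=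
  E.Nonempty ∧ (∀ e ∈ E, ∀ s ∈ S, e + s ∈ E) ∧ (∃ a ∈ S, ∀ e ∈ E, a + e ∈ S) ∧
  MinClosed E ∧ G3P E

/-- A saturated chain of length `n` in `E`. -/
def IsSatChain (E : Set Z2) (n : ℕ) (f : ℕ → Z2) : Prop :=
  (∀ i ≤ n, f i ∈ E) ∧ (∀ i < n, f i < f (i + 1)) ∧
  (∀ i < n, ∀ c ∈ E, ¬ (f i < c ∧ c < f (i + 1)))

/-- `d_E(a,b)`: the common length of all saturated chains in `E` from `a` to `b`. -/
noncomputable def chainDist (E : Set Z2) (a b : Z2) : ℕ :=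
  sSup {n : ℕ | ∃ f : ℕ → Z2, IsSatChain E n f ∧ f 0 = a ∧ f n = b}

/-- The (componentwise) minimal element `e(E)` of `E`. -/
noncomputable def minEl (E : Set Z2) : Z2 :=
  (sInf (Prod.fst '' E), sInf (Prod.snd '' E))

/-- The distance `d(E∖F)` between `F ⊆ E`: the common value of
`d_E(e(E),α) - d_F(e(F),α)` for all sufficiently large `α ∈ F`. -/
noncomputable def dist2 (E F : Set Z2) : ℤ :=
  sSup {z : ℤ | ∃ β : Z2, ∀ α ∈ F, β ≤ α →
    (chainDist E (minEl E) α : ℤ) - (chainDist F (minEl F) α : ℤ) = z}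

/-- The conductor `c(E)`: the componentwise minimal `δ` with `δ + ℕ² ⊆ E`. -/
noncomputable def condE (E : Set Z2) : Z2 :=
  (sInf ((fun δ : Z2 => δ.1) '' {δ : Z2 | ∀ y : Z2, δ ≤ y → y ∈ E}),
   sInf ((fun δ : Z2 => δ.2) '' {δ : Z2 | ∀ y : Z2, δ ≤ y → y ∈ E}))

/-- The conductor ideal `C(E) = {β ∈ E : β ≥ c(E)}`. -/
noncomputable def CIdeal (E : Set Z2) : Set Z2 := {b ∈ E | condE E ≤ b}

/-- The length `l(E) = d(E ∖ C(E))`. -/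
noncomputable def glen (E : Set Z2) : ℤ := dist2 E (CIdeal E)

/-- The genus `g(E) = d(ℕ² ∖ E)`. -/
noncomputable def genus (E : Set Z2) : ℤ := dist2 orth E

/-- The good semigroup `ℕ²(1,1) = {0} ∪ ((1,1) + ℕ²)`. -/
def N2oneone : Set Z2 := {a : Z2 | a = 0 ∨ ((1 : ℤ), (1 : ℤ)) ≤ a}
/-- The space `(ℕ ∪ {∞})²`, modelled inside `(ℤ ∪ {∞})²`. -/
abbrev Om : Type := WithTop ℤ × WithTop ℤ

/-- The embedding of `ℤ²` into `(ℤ ∪ {∞})²`. -/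
def iotaZ (a : Z2) : Om := ((a.1 : WithTop ℤ), (a.2 : WithTop ℤ))

/-- `S^∞`: the elements `(a,∞)` with `(a,c₂) ∈ S` and `(∞,b)` with `(c₁,b) ∈ S`,
where `(c₁,c₂)` is the conductor of `S`. -/
noncomputable def Sinf (S : Set Z2) : Set Om :=
  {w : Om | (∃ a : ℤ, w = ((a : WithTop ℤ), ⊤) ∧ (a, (condE S).2) ∈ S) ∨
            (∃ b : ℤ, w = (⊤, (b : WithTop ℤ)) ∧ ((condE S).1, b) ∈ S)}

/-- `Γ_S = S ∪ S^∞`. -/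
noncomputable def Gam (S : Set Z2) : Set Om := iotaZ '' S ∪ Sinf S

/-- `I(S)`: the set of irreducible elements of `Γ_S`. -/
noncomputable def ISet (S : Set Z2) : Set Om :=
  {w ∈ Gam S | w ≠ 0 ∧ ∀ b ∈ Gam S, ∀ c ∈ Gam S, w = b + c → w = b ∨ w = c}

/-- `Δ(a) = Δ₁(a) ∪ Δ₂(a)` for a finite element `a ∈ ℤ²`. -/
def DeltaUp (a : Z2) : Set Z2 :=
  {b : Z2 | (b.1 = a.1 ∧ a.2 < b.2) ∨ (b.2 = a.2 ∧ a.1 < b.1)}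

/-- `A_f(S)`: the finite maximals of `S`, i.e. `a ∈ S` with `Δ^S(a) = ∅`. -/
def Af (S : Set Z2) : Set Z2 := {a ∈ S | S ∩ DeltaUp a = ∅}

/-- `I_A(S)`: the irreducible maximals, i.e. irreducible elements of
`A(S) = A_f(S) ∪ S^∞`. -/
noncomputable def IA (S : Set Z2) : Set Om := ISet S ∩ (iotaZ '' Af S ∪ Sinf S)

/-- `₁Δ(w)` (as a subset of `ℤ²`), including the conventions for infinite `w`. -/
def lowD1 (w : Om) : Set Z2 :=
  {b : Z2 | (b.1 : WithTop ℤ) = w.1 ∧ (b.2 : WithTop ℤ) < w.2}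

/-- `₂Δ(w)` (as a subset of `ℤ²`), including the conventions for infinite `w`. -/
def lowD2 (w : Om) : Set Z2 :=
  {b : Z2 | (b.2 : WithTop ℤ) = w.2 ∧ (b.1 : WithTop ℤ) < w.1}

/-- `Δ(w)` (as a subset of `ℤ²`) for a possibly infinite `w`. -/
def upD (w : Om) : Set Z2 :=
  {b : Z2 | ((b.1 : WithTop ℤ) = w.1 ∧ w.2 < (b.2 : WithTop ℤ)) ∨
            ((b.2 : WithTop ℤ) = w.2 ∧ w.1 < (b.1 : WithTop ℤ))}

/-- `{w} ∩ ℤ²`: the singleton of `w` if `w` is finite, `∅` otherwise. -/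
def finPart (w : Om) : Set Z2 := {b : Z2 | iotaZ b = w}

/-- `a` and `b` are connected by a piece of track. -/
def Piece (S : Set Z2) (a b : Om) : Prop :=
  ¬ a ≤ b ∧ ¬ b ≤ a ∧ ∀ s ∈ S, s ∈ upD (a ⊓ b) → iotaZ s ∈ ISet S

/-- The data `α 0, …, α (n-1)` of a track of `S` (with `n ≥ 1` points;
`n = 1` gives the one-point tracks `T((α))`). -/
def TrackData (S : Set Z2) (n : ℕ) (α : ℕ → Om) : Prop :=
  1 ≤ n ∧ (∀ i < n, α i ∈ IA S) ∧
  (∀ i j, i < j → j < n → (α i).1 < (α j).1) ∧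
  (∀ s ∈ S, s ∈ lowD2 (α 0) → iotaZ s ∈ ISet S) ∧
  (∀ s ∈ S, s ∈ lowD1 (α (n - 1)) → iotaZ s ∈ ISet S) ∧
  (∀ i, i + 1 < n → Piece S (α i) (α (i + 1)))

/-- The track `T((α 0,…,α (n-1)))` as a subset of `S`. -/
def trackSet (S : Set Z2) (n : ℕ) (α : ℕ → Om) : Set Z2 :=
  finPart (α 0) ∪ S ∩ lowD2 (α 0) ∪
  (⋃ i ∈ Finset.range (n - 1), S ∩ upD (α i ⊓ α (i + 1))) ∪
  S ∩ lowD1 (α (n - 1)) ∪ finPart (α (n - 1))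

/-- `T` is a track of `S`. -/
def IsTrack (S T : Set Z2) : Prop :=
  ∃ (n : ℕ) (α : ℕ → Om), TrackData S n α ∧ T = trackSet S n α

/-- `T` is a beyond track of `S`: a track meeting `{a ∈ S : a ≥ c(S)}`. -/
noncomputable def IsBeyondTrack (S T : Set Z2) : Prop :=
  IsTrack S T ∧ (T ∩ {a ∈ S | condE S ≤ a}).Nonempty

/-- `S` is a special parent of `S'`: `S` is a (local) good semigroup and
`S' = S ∖ T` for some beyond track `T` of `S`. -/
noncomputable def SpecialParent (S S' : Set Z2) : Prop :=
  IsGood S ∧ IsLocal S ∧ ∃ T : Set Z2, IsBeyondTrack S T ∧ S' = S \ T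

/-- `T ∈ T(S)`: if `c₂ = 1` this means `T` is any beyond track of `S`;
if `c₂ ≠ 1` it means `T` is a beyond track whose ending point is some
`(∞, b)` with `b ≥ c₂`. -/
noncomputable def InTS (S T : Set Z2) : Prop :=
  ((condE S).2 = 1 ∧ IsBeyondTrack S T) ∨
  ((condE S).2 ≠ 1 ∧ ∃ (n : ℕ) (α : ℕ → Om), TrackData S n α ∧
    T = trackSet S n α ∧ (T ∩ {a ∈ S | condE S ≤ a}).Nonempty ∧
    ((⊤ : WithTop ℤ), ((condE S).2 : WithTop ℤ)) ≤ α (n - 1))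

/-- The image of `S` under exchanging the two coordinates. -/
def swapSet (S : Set Z2) : Set Z2 := {s | s.swap ∈ S}

lemma mem_swapSet {S : Set Z2} {x y : ℤ} : (x, y) ∈ swapSet S ↔ (y, x) ∈ S := Iff.rfl

lemma swapSet_swapSet (S : Set Z2) : swapSet (swapSet S) = S := rfl

lemma IsGood.swapSet {S : Set Z2} (h : IsGood S) : IsGood (swapSet S) := by
  obtain ⟨h0, h1, h2, h3, ⟨δ, h4⟩, h5⟩ := h
  refine ⟨fun s hs => (h0 hs).symm, h1, fun a ha b hb => h2 _ ha _ hb,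
    fun a ha b hb => h3 _ ha _ hb, ⟨δ.swap, fun y hy => h4 _ ⟨hy.2, hy.1⟩⟩, ?_⟩
  intro a ha b hb hab
  have hab' : a.swap ≠ b.swap := fun h => hab (Prod.swap_injective h)
  obtain ⟨k1, k2⟩ := h5 _ ha _ hb hab'
  refine ⟨fun h => ?_, fun h => ?_⟩
  · obtain ⟨e, he, h⟩ := k2 h
    exact ⟨e.swap, he, h⟩
  · obtain ⟨e, he, h⟩ := k1 h
    exact ⟨e.swap, he, h⟩

lemma IsLocal.swapSet {S : Set Z2} (h : IsLocal S) : IsLocal (swapSet S) :=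
  fun _ ha h0 => Prod.swap_injective (h _ ha h0.symm)

lemma condE_swapSet (S : Set Z2) : condE (swapSet S) = (condE S).swap := by
  have key : ∀ δ : Z2, (∀ y : Z2, δ ≤ y → y ∈ swapSet S) ↔ ∀ y : Z2, δ.swap ≤ y → y ∈ S :=
    fun δ => ⟨fun h y hy => h y.swap ⟨hy.2, hy.1⟩, fun h y hy => h y.swap ⟨hy.2, hy.1⟩⟩
  unfold condE
  ext1
  · dsimp only [Prod.fst_swap]
    congr 1
    ext z
    exact ⟨fun ⟨δ, hδ, h⟩ => ⟨δ.swap, (key δ).1 hδ, h⟩,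
      fun ⟨δ, hδ, h⟩ => ⟨δ.swap, (key δ.swap).2 hδ, h⟩⟩
  · dsimp only [Prod.snd_swap]
    congr 1
    ext z
    exact ⟨fun ⟨δ, hδ, h⟩ => ⟨δ.swap, (key δ).1 hδ, h⟩,
      fun ⟨δ, hδ, h⟩ => ⟨δ.swap, (key δ.swap).2 hδ, h⟩⟩

lemma condE_le {S : Set Z2} (h : IsGood S) {δ : Z2} (hδ : ∀ y : Z2, δ ≤ y → y ∈ S) :
    condE S ≤ δ :=
  ⟨csInf_le ⟨0, by rintro _ ⟨ε, hε, rfl⟩; exact (h.1 (hε ε le_rfl)).1⟩ ⟨δ, hδ, rfl⟩,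
   csInf_le ⟨0, by rintro _ ⟨ε, hε, rfl⟩; exact (h.1 (hε ε le_rfl)).2⟩ ⟨δ, hδ, rfl⟩⟩

lemma mem_of_condE_le {S : Set Z2} (h : IsGood S) {x y : ℤ} (hx : (condE S).1 ≤ x)
    (hy : (condE S).2 ≤ y) : (x, y) ∈ S := by
  obtain ⟨δ₀, h₀⟩ := h.2.2.2.2.1
  have m1 := Int.csInf_mem (s := (fun δ : Z2 => δ.1) '' {δ : Z2 | ∀ y : Z2, δ ≤ y → y ∈ S})
    ⟨_, δ₀, h₀, rfl⟩ ⟨0, by rintro _ ⟨ε, hε, rfl⟩; exact (h.1 (hε ε le_rfl)).1⟩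
  have m2 := Int.csInf_mem (s := (fun δ : Z2 => δ.2) '' {δ : Z2 | ∀ y : Z2, δ ≤ y → y ∈ S})
    ⟨_, δ₀, h₀, rfl⟩ ⟨0, by rintro _ ⟨ε, hε, rfl⟩; exact (h.1 (hε ε le_rfl)).2⟩
  obtain ⟨⟨p, q⟩, hp, hp'⟩ := m1
  obtain ⟨⟨p', q'⟩, hq, hq'⟩ := m2
  change p = (condE S).1 at hp'
  change q' = (condE S).2 at hq'
  have a1 : (x, max y q) ∈ S := hp _ ⟨by dsimp; omega, by dsimp; omega⟩
  have a2 : (max x p', y) ∈ S := hq _ ⟨by dsimp; omega, by dsimp; omega⟩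
  have := h.2.2.2.1 _ a1 _ a2
  simpa using this

lemma IsGood.min_mem {S : Set Z2} (h : IsGood S) {x y x' y' : ℤ} (h1 : (x, y) ∈ S)
    (h2 : (x', y') ∈ S) : (min x x', min y y') ∈ S :=
  h.2.2.2.1 _ h1 _ h2

lemma IsGood.add_mem {S : Set Z2} (h : IsGood S) {x y x' y' : ℤ} (h1 : (x, y) ∈ S)
    (h2 : (x', y') ∈ S) : (x + x', y + y') ∈ S :=
  h.2.2.1 _ h1 _ h2

lemma IsGood.exists_right {S : Set Z2} (h : IsGood S) {x y y' : ℤ} (h1 : (x, y) ∈ S)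
    (h2 : (x, y') ∈ S) (hy : y < y') : ∃ e, x < e ∧ (e, y) ∈ S := by
  obtain ⟨⟨e1, e2⟩, he, h3, -, h5⟩ := (h.2.2.2.2.2 _ h1 _ h2 (by simp; omega)).1 rfl
  have : e2 = min y y' := h5 (by dsimp; omega)
  obtain rfl : e2 = y := by omega
  exact ⟨e1, h3, he⟩

lemma IsGood.exists_above {S : Set Z2} (h : IsGood S) {x x' y : ℤ} (h1 : (x, y) ∈ S)
    (h2 : (x', y) ∈ S) (hx : x < x') : ∃ e, y < e ∧ (x, e) ∈ S :=
  h.swapSet.exists_right h1 h2 hx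

lemma IsGood.nonneg {S : Set Z2} (h : IsGood S) {x y : ℤ} (h1 : (x, y) ∈ S) : 0 ≤ x ∧ 0 ≤ y :=
  h.1 h1

lemma IsLocal.pos {S : Set Z2} (hl : IsLocal S) (h : IsGood S) {x y : ℤ} (h1 : (x, y) ∈ S)
    (h0 : (x, y) ≠ 0) : 1 ≤ x ∧ 1 ≤ y := by
  have := h.nonneg h1
  have h2 : ¬ (x = 0 ∨ y = 0) := fun hh => h0 (hl _ h1 hh)
  omega

/-- Above the conductor, membership does not depend on the second coordinate. -/
lemma IsGood.mem_column {S : Set Z2} (h : IsGood S) {x y y' : ℤ} (h1 : (x, y) ∈ S)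
    (hy : (condE S).2 ≤ y) (hy' : (condE S).2 ≤ y') : (x, y') ∈ S := by
  have up : ∀ k : ℕ, ∃ z, y + k ≤ z ∧ (x, z) ∈ S := by
    intro k
    induction k with
    | zero => exact ⟨y, by simp, h1⟩
    | succ k ih =>
      obtain ⟨z, hz, hz'⟩ := ih
      obtain ⟨e, he, he'⟩ := h.exists_above hz'
        (mem_of_condE_le h (x := max x (condE S).1 + 1) (y := z) (by omega) (by omega)) (by omega)
      exact ⟨e, by push_cast; omega, he'⟩
  obtain ⟨z, hz, hz'⟩ := up (y' - y).toNat
  have := h.min_mem hz' (mem_of_condE_le h (x := max x (condE S).1) (y := y') (by omega) hy')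
  rwa [min_eq_left (by omega), min_eq_right (by omega)] at this

/-- Above the conductor, membership does not depend on the first coordinate. -/
lemma IsGood.mem_row {S : Set Z2} (h : IsGood S) {x x' y : ℤ} (h1 : (x, y) ∈ S)
    (hx : (condE S).1 ≤ x) (hx' : (condE S).1 ≤ x') : (x', y) ∈ S :=
  h.swapSet.mem_column (x := y) (y := x) (y' := x') h1
    (by simpa [condE_swapSet] using hx) (by simpa [condE_swapSet] using hx')

lemma IsLocal.one_le_condE_snd {S : Set Z2} (hl : IsLocal S) (h : IsGood S) :
    1 ≤ (condE S).2 := by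
  have h1 := mem_of_condE_le h (x := max 1 (condE S).1) (y := (condE S).2) (by omega) le_rfl
  exact (hl.pos h h1 (by simp [Prod.ext_iff]; omega)).2

lemma IsLocal.one_le_condE_fst {S : Set Z2} (hl : IsLocal S) (h : IsGood S) :
    1 ≤ (condE S).1 := by
  simpa [condE_swapSet] using hl.swapSet.one_le_condE_snd h.swapSet

/-- The row just below the conductor has no elements to the right of the conductor. -/
lemma IsGood.notMem_row {S : Set Z2} (h : IsGood S) {x : ℤ} (hx : (condE S).1 ≤ x) :
    (x, (condE S).2 - 1) ∉ S := by
  intro hm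
  have : condE S ≤ ((condE S).1, (condE S).2 - 1) := by
    refine condE_le h ?_
    rintro ⟨u, v⟩ ⟨hu, hv⟩
    dsimp at hu hv
    rcases eq_or_lt_of_le hv with rfl | hv
    · exact h.mem_row hm hx hu
    · exact mem_of_condE_le h hu (by omega)
  have := this.2
  dsimp at this
  omega

/-- The rows of `S` below height `m`, together with all `(x, y)`, `m ≤ y`, such that the
column of `x` meets `S` at height at least `m`. -/
def rowFill (S : Set Z2) (m : ℤ) : Set Z2 :=
  {s | (s ∈ S ∧ s.2 < m) ∨ (m ≤ s.2 ∧ ∃ y, m ≤ y ∧ (s.1, y) ∈ S)}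

lemma subset_rowFill (S : Set Z2) (m : ℤ) : S ⊆ rowFill S m := by
  rintro ⟨x, y⟩ hs
  rcases lt_or_ge y m with h | h
  · exact Or.inl ⟨hs, h⟩
  · exact Or.inr ⟨h, y, h, hs⟩

lemma isGood_rowFill {S : Set Z2} (h : IsGood S) {m : ℤ} (hm : 1 ≤ m) :
    IsGood (rowFill S m) := by
  obtain ⟨δ, hδ⟩ := h.2.2.2.2.1
  refine ⟨?_, subset_rowFill _ _ h.2.1, ?_, ?_, ⟨δ, fun y hy => subset_rowFill _ _ (hδ y hy)⟩, ?_⟩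
  · rintro ⟨x, y⟩ (⟨hs, -⟩ | ⟨hy, z, -, hs⟩)
    · exact h.1 hs
    · have := h.nonneg hs
      dsimp at hy
      exact ⟨this.1, by dsimp; omega⟩
  · have key : ∀ x y x' y' : ℤ, m ≤ y → (∃ z, m ≤ z ∧ (x, z) ∈ S) → (x', y') ∈ rowFill S m →
        (x + x', y + y') ∈ rowFill S m := by
      rintro x y x' y' hy ⟨z, hz, hs⟩ (⟨hs', -⟩ | ⟨hy', z', hz', hs'⟩)
      · have := h.nonneg hs'
        exact Or.inr ⟨by dsimp; omega, z + y', by omega, h.add_mem hs hs'⟩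
      · dsimp at hy'
        exact Or.inr ⟨by dsimp; omega, z + z', by omega, h.add_mem hs hs'⟩
    rintro ⟨x, y⟩ (⟨hs, hy⟩ | ⟨hy, hs⟩) ⟨x', y'⟩ hs'
    · rcases hs' with ⟨hs', hy'⟩ | ⟨hy', hs'⟩
      · exact subset_rowFill _ _ (h.add_mem hs hs')
      · rw [add_comm]
        exact key _ _ _ _ hy' hs' (Or.inl ⟨hs, hy⟩)
    · exact key _ _ _ _ hy hs hs'
  · have key : ∀ x y x' y' : ℤ, m ≤ y → (∃ z, m ≤ z ∧ (x, z) ∈ S) → (x', y') ∈ rowFill S m →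
        (min x x', min y y') ∈ rowFill S m := by
      rintro x y x' y' hy ⟨z, hz, hs⟩ (⟨hs', hy'⟩ | ⟨hy', z', hz', hs'⟩)
      · have := h.min_mem hs hs'
        dsimp at hy'
        rw [min_eq_right (a := z) (by omega)] at this
        rw [min_eq_right (a := y) (by omega)]
        exact subset_rowFill _ _ this
      · dsimp at hy'
        exact Or.inr ⟨by dsimp; omega, min z z', by omega, h.min_mem hs hs'⟩
    rintro ⟨x, y⟩ (⟨hs, hy⟩ | ⟨hy, hs⟩) ⟨x', y'⟩ hs'
    · rcases hs' with ⟨hs', hy'⟩ | ⟨hy', hs'⟩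
      · exact subset_rowFill _ _ (h.min_mem hs hs')
      · rw [inf_comm]
        exact key _ _ _ _ hy' hs' (Or.inl ⟨hs, hy⟩)
    · exact key _ _ _ _ hy hs hs'
  · have right : ∀ x y y' : ℤ, (x, y) ∈ rowFill S m → (x, y') ∈ rowFill S m → y < y' →
        ∃ e, x < e ∧ (e, y) ∈ rowFill S m := by
      rintro x y y' hs hs' hlt
      rcases hs with ⟨hs, hy⟩ | ⟨hy, -⟩
      · obtain ⟨z, hz, hs'⟩ : ∃ z, y < z ∧ (x, z) ∈ S := by
          rcases hs' with ⟨hs', -⟩ | ⟨-, z, hz, hs'⟩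
          · exact ⟨y', hlt, hs'⟩
          · dsimp at hy
            exact ⟨z, by omega, hs'⟩
        obtain ⟨e, he, hs⟩ := h.exists_right hs hs' hz
        exact ⟨e, he, subset_rowFill _ _ hs⟩
      · refine ⟨max (x + 1) δ.1, by omega, Or.inr ⟨hy, max m δ.2, by omega, hδ _ ?_⟩⟩
        exact ⟨by dsimp; omega, by dsimp; omega⟩
    have above : ∀ x x' y : ℤ, (x, y) ∈ rowFill S m → (x', y) ∈ rowFill S m → x < x' →
        ∃ e, y < e ∧ (x, e) ∈ rowFill S m := by
      rintro x x' y hs hs' hlt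
      rcases hs with ⟨hs, hy⟩ | ⟨hy, hs⟩
      · rcases hs' with ⟨hs', -⟩ | ⟨hy', -⟩
        · obtain ⟨e, he, hs⟩ := h.exists_above hs hs' hlt
          exact ⟨e, he, subset_rowFill _ _ hs⟩
        · dsimp at hy hy'
          omega
      · dsimp at hy
        exact ⟨y + 1, by omega, Or.inr ⟨by dsimp; omega, hs⟩⟩
    rintro ⟨x, y⟩ ha ⟨x', y'⟩ hb hab
    refine ⟨fun hx => ?_, fun hy => ?_⟩
    · obtain rfl : x = x' := hx
      have hne : y ≠ y' := fun hh => hab (by rw [hh])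
      rcases lt_or_gt_of_ne hne with hlt | hlt
      · obtain ⟨e, he, hs⟩ := right _ _ _ ha hb hlt
        exact ⟨_, hs, he, by dsimp; omega, fun _ => by dsimp; omega⟩
      · obtain ⟨e, he, hs⟩ := right _ _ _ hb ha hlt
        exact ⟨_, hs, he, by dsimp; omega, fun _ => by dsimp; omega⟩
    · obtain rfl : y = y' := hy
      have hne : x ≠ x' := fun hh => hab (by rw [hh])
      rcases lt_or_gt_of_ne hne with hlt | hlt
      · obtain ⟨e, he, hs⟩ := above _ _ _ ha hb hlt
        exact ⟨_, hs, he, by dsimp; omega, fun _ => by dsimp; omega⟩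
      · obtain ⟨e, he, hs⟩ := above _ _ _ hb ha hlt
        exact ⟨_, hs, he, by dsimp; omega, fun _ => by dsimp; omega⟩

lemma isLocal_rowFill {S : Set Z2} (h : IsGood S) (hl : IsLocal S) {m : ℤ} (hm : 1 ≤ m) :
    IsLocal (rowFill S m) := by
  rintro ⟨x, y⟩ (⟨hs, -⟩ | ⟨hy, z, hz, hs⟩) h0
  · exact hl _ hs h0
  · have := hl.pos h hs (by simp [Prod.ext_iff]; omega)
    dsimp at hy h0
    omega

/-! ### The extended semigroup `Γ_S` -/

lemma coe_mem_Gam {S : Set Z2} {x y : ℤ} :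
    ((x : WithTop ℤ), (y : WithTop ℤ)) ∈ Gam S ↔ (x, y) ∈ S := by
  simp [Gam, Sinf, iotaZ, Prod.ext_iff]

lemma top_coe_mem_Sinf {S : Set Z2} {y : ℤ} :
    ((⊤ : WithTop ℤ), (y : WithTop ℤ)) ∈ Sinf S ↔ ((condE S).1, y) ∈ S := by
  simp [Sinf, Prod.ext_iff]

lemma coe_top_mem_Sinf {S : Set Z2} {x : ℤ} :
    ((x : WithTop ℤ), (⊤ : WithTop ℤ)) ∈ Sinf S ↔ (x, (condE S).2) ∈ S := by
  simp [Sinf, Prod.ext_iff]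

lemma top_coe_mem_Gam {S : Set Z2} {y : ℤ} :
    ((⊤ : WithTop ℤ), (y : WithTop ℤ)) ∈ Gam S ↔ ((condE S).1, y) ∈ S := by
  simp [Gam, Sinf, iotaZ, Prod.ext_iff]

lemma coe_top_mem_Gam {S : Set Z2} {x : ℤ} :
    ((x : WithTop ℤ), (⊤ : WithTop ℤ)) ∈ Gam S ↔ (x, (condE S).2) ∈ S := by
  simp [Gam, Sinf, iotaZ, Prod.ext_iff]

lemma top_top_notMem_Gam {S : Set Z2} : ((⊤ : WithTop ℤ), (⊤ : WithTop ℤ)) ∉ Gam S := by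
  simp [Gam, Sinf, iotaZ, Prod.ext_iff]

lemma swap_mem_Gam {S : Set Z2} {w : Om} : w.swap ∈ Gam (swapSet S) ↔ w ∈ Gam S := by
  obtain ⟨p, q⟩ := w
  induction p using WithTop.recTopCoe <;> induction q using WithTop.recTopCoe <;>
    simp only [Prod.swap, coe_mem_Gam, top_coe_mem_Gam, coe_top_mem_Gam, top_top_notMem_Gam,
      condE_swapSet, mem_swapSet]

lemma mem_ISet_of_swap {S : Set Z2} {w : Om} (hw : w.swap ∈ ISet (swapSet S)) : w ∈ ISet S := by
  obtain ⟨h1, h2, h3⟩ := hw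
  refine ⟨swap_mem_Gam.1 h1, fun h => h2 (by rw [h]; rfl), fun b hb c hc hbc => ?_⟩
  exact (h3 _ (swap_mem_Gam.2 hb) _ (swap_mem_Gam.2 hc) (by rw [hbc]; rfl)).imp
    (fun h => Prod.swap_injective h) (fun h => Prod.swap_injective h)

/-- A finite element outside a subsemigroup `S'` that contains all strictly smaller
elements of `S` is irreducible. -/
lemma iotaZ_mem_ISet {S S' : Set Z2} (h : IsGood S) (hl : IsLocal S) (h' : IsGood S') {x y : ℤ}
    (hs : (x, y) ∈ S) (hs' : (x, y) ∉ S')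
    (hlt : ∀ u v, (u, v) ∈ S → u < x → v < y → (u, v) ∈ S') : iotaZ (x, y) ∈ ISet S := by
  refine ⟨Or.inl ⟨_, hs, rfl⟩, ?_, ?_⟩
  · intro h0
    apply hs'
    have : (x, y) = (0 : Z2) := by simpa [iotaZ, Prod.ext_iff] using h0
    rw [this]
    exact h'.2.1
  · rintro ⟨p, q⟩ hb ⟨p', q'⟩ hc hbc
    simp only [iotaZ, Prod.mk_add_mk, Prod.mk.injEq] at hbc
    induction p using WithTop.recTopCoe with
    | top => simp at hbc
    | coe p =>
    induction q using WithTop.recTopCoe with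
    | top => simp at hbc
    | coe q =>
    induction p' using WithTop.recTopCoe with
    | top => simp at hbc
    | coe p' =>
    induction q' using WithTop.recTopCoe with
    | top => simp at hbc
    | coe q' =>
    rw [coe_mem_Gam] at hb hc
    norm_cast at hbc
    obtain ⟨rfl, rfl⟩ := hbc
    by_cases b0 : (p, q) = (0 : Z2)
    · obtain ⟨rfl, rfl⟩ : p = 0 ∧ q = 0 := by simpa [Prod.ext_iff] using b0
      right; simp [iotaZ]
    by_cases c0 : (p', q') = (0 : Z2)
    · obtain ⟨rfl, rfl⟩ : p' = 0 ∧ q' = 0 := by simpa [Prod.ext_iff] using c0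
      left; simp [iotaZ]
    have pb := hl.pos h hb b0
    have pc := hl.pos h hc c0
    exact absurd (h'.add_mem (hlt _ _ hb (by omega) (by omega)) (hlt _ _ hc (by omega) (by omega)))
      hs'

lemma top_coe_mem_ISet {S S' : Set Z2} (h : IsGood S) (hl : IsLocal S) (h' : IsGood S') {m : ℤ}
    (hs : ((condE S).1, m) ∈ S) (hs' : ∀ N, ∃ x, N ≤ x ∧ (x, m) ∉ S')
    (hlt : ∀ u v, (u, v) ∈ S → v < m → (u, v) ∈ S') :
    ((⊤ : WithTop ℤ), (m : WithTop ℤ)) ∈ ISet S := by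
  refine ⟨top_coe_mem_Gam.2 hs, by simp [Prod.ext_iff], ?_⟩
  have hc1 := hl.one_le_condE_fst h
  have hinf : ∀ q x : ℤ, (condE S).1 ≤ x → ((condE S).1, q) ∈ S → (x, q) ∈ S ∧ 1 ≤ q := by
    intro q x hx hq
    exact ⟨h.mem_row hq le_rfl hx, (hl.pos h hq (by simp [Prod.ext_iff]; omega)).2⟩
  have mixed : ∀ q p' q' : ℤ, ((condE S).1, q) ∈ S → (p', q') ∈ S → 1 ≤ q' → m = q + q' →
      False := by
    intro q p' q' hq hq' h1 hmq
    have h2 := (hinf q _ le_rfl hq).2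
    obtain ⟨x, hx, hx'⟩ := hs' ((condE S).1 + p')
    refine hx' ?_
    have := h'.add_mem (hlt _ _ (hinf q (x - p') (by omega) hq).1 (by omega))
      (hlt _ _ hq' (by omega))
    rwa [sub_add_cancel, ← hmq] at this
  rintro ⟨p, q⟩ hb ⟨p', q'⟩ hc hbc
  simp only [Prod.mk_add_mk, Prod.mk.injEq] at hbc
  induction q using WithTop.recTopCoe with
  | top => simp at hbc
  | coe q =>
  induction q' using WithTop.recTopCoe with
  | top => simp at hbc
  | coe q' =>
  have hmq : m = q + q' := by exact_mod_cast hbc.2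
  induction p using WithTop.recTopCoe with
  | top =>
    rw [top_coe_mem_Gam] at hb
    induction p' using WithTop.recTopCoe with
    | top =>
      rw [top_coe_mem_Gam] at hc
      exact (mixed _ _ _ hb hc (hinf q' _ le_rfl hc).2 hmq).elim
    | coe p' =>
      rw [coe_mem_Gam] at hc
      by_cases c0 : (p', q') = (0 : Z2)
      · obtain ⟨rfl, rfl⟩ : p' = 0 ∧ q' = 0 := by simpa [Prod.ext_iff] using c0
        left; simp [hmq]
      · exact (mixed _ _ _ hb hc (hl.pos h hc c0).2 hmq).elim
  | coe p =>
    rw [coe_mem_Gam] at hb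
    induction p' using WithTop.recTopCoe with
    | top =>
      rw [top_coe_mem_Gam] at hc
      by_cases b0 : (p, q) = (0 : Z2)
      · obtain ⟨rfl, rfl⟩ : p = 0 ∧ q = 0 := by simpa [Prod.ext_iff] using b0
        right; simp [hmq]
      · exact (mixed _ _ _ hc hb (hl.pos h hb b0).2 (by omega)).elim
    | coe p' =>
      have := hbc.1
      norm_cast at this

lemma coe_top_mem_ISet {S S' : Set Z2} (h : IsGood S) (hl : IsLocal S) (h' : IsGood S') {m : ℤ}
    (hs : (m, (condE S).2) ∈ S) (hs' : ∀ N, ∃ y, N ≤ y ∧ (m, y) ∉ S')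
    (hlt : ∀ u v, (u, v) ∈ S → u < m → (u, v) ∈ S') :
    ((m : WithTop ℤ), (⊤ : WithTop ℤ)) ∈ ISet S :=
  mem_ISet_of_swap (top_coe_mem_ISet h.swapSet hl.swapSet h'.swapSet
    (by rwa [condE_swapSet]) hs' (fun u v hu => hlt v u hu))

/-! ### Existence -/

/-- Beyond tracks ending at `(∞, m)` with `m ≥ c₂` belong to `T(S)`. -/
lemma inTS_of_top_coe {S T : Set Z2} {n : ℕ} {α : ℕ → Om} {m x : ℤ} (hα : TrackData S n α)
    (hT : T = trackSet S n α) (hx : (x, m) ∈ T) (hxS : (x, m) ∈ S) (hc : condE S ≤ (x, m))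
    (hend : α (n - 1) = ((⊤ : WithTop ℤ), (m : WithTop ℤ))) : InTS S T := by
  by_cases h1 : (condE S).2 = 1
  · exact Or.inl ⟨h1, ⟨n, α, hα, hT⟩, _, hx, hxS, hc⟩
  · refine Or.inr ⟨h1, n, α, hα, hT, ⟨_, hx, hxS, hc⟩, ?_⟩
    rw [hend]
    exact ⟨le_rfl, WithTop.coe_le_coe.2 hc.2⟩

lemma mem_of_mem_rowFill {S' : Set Z2} (h' : IsGood S') {x y : ℤ}
    (hs : (x, y) ∈ rowFill S' ((condE S').2 - 1)) (hy : (condE S').2 ≤ y) :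
    (x, y) ∈ S' ∨ (x, (condE S').2 - 1) ∈ S' := by
  rcases hs with ⟨hs, -⟩ | ⟨-, z, hz, hs⟩
  · exact Or.inl hs
  · dsimp at hs
    rcases eq_or_lt_of_le hz with rfl | hz
    · exact Or.inr hs
    · exact Or.inl (h'.mem_column hs (by omega) hy)

lemma exists_inTS_rowFill {S' : Set Z2} (h' : IsGood S') (hl' : IsLocal S')
    (hc : 2 ≤ (condE S').2) :
    ∃ T, InTS (rowFill S' ((condE S').2 - 1)) T ∧
      S' = rowFill S' ((condE S').2 - 1) \ T := by
  have hrow : ∀ x, (condE S').1 ≤ x → (x, (condE S').2 - 1) ∉ S' := fun x hx => h'.notMem_row hx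
  have hfill := fun x y => mem_of_mem_rowFill h' (x := x) (y := y)
  have hS'c := fun x y => mem_of_condE_le h' (x := x) (y := y)
  obtain ⟨m, hm⟩ : ∃ m, m = (condE S').2 - 1 := ⟨_, rfl⟩
  have hc2 : (condE S').2 = m + 1 := by omega
  rw [← hm] at hrow hfill ⊢
  rw [hc2] at hfill hS'c
  have hm1 : 1 ≤ m := by omega
  have h := isGood_rowFill h' hm1
  have hl := isLocal_rowFill h' hl' hm1
  have hsub := subset_rowFill S' m
  have hlow : ∀ u v, (u, v) ∈ rowFill S' m → v < m → (u, v) ∈ S' := by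
    rintro u v (⟨hs, -⟩ | ⟨hv, -⟩) hlt
    · exact hs
    · dsimp at hv; omega
  have hbig : ∀ x y, (condE S').1 ≤ x → m ≤ y → (x, y) ∈ rowFill S' m := fun x y hx hy =>
    Or.inr ⟨hy, m + 1, by omega, hS'c x (m + 1) hx le_rfl⟩
  have hcle : condE (rowFill S' m) ≤ ((condE S').1, m) :=
    condE_le h fun y hy => hbig y.1 y.2 hy.1 hy.2
  have hrowfull : ((condE (rowFill S' m)).1, m) ∈ rowFill S' m :=
    mem_of_condE_le h le_rfl hcle.2
  have hIA2 : ((⊤ : WithTop ℤ), (m : WithTop ℤ)) ∈ IA (rowFill S' m) :=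
    ⟨top_coe_mem_ISet h hl h' hrowfull
      (fun N => ⟨max N (condE S').1, by omega, hrow _ (by omega)⟩) hlow,
      Or.inr (top_coe_mem_Sinf.2 hrowfull)⟩
  by_cases hex : ∃ x, (x, m) ∈ S'
  · obtain ⟨a, ha, hmax⟩ := Int.exists_greatest_of_bdd (P := fun x => (x, m) ∈ S')
      ⟨(condE S').1, fun z hz => by
        by_contra hcon
        exact hrow z (by omega) hz⟩ hex
    have hcol : ∀ y, m < y → (a, y) ∉ S' := by
      intro y hy hs
      obtain ⟨e, he, hs⟩ := h'.exists_right ha hs hy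
      have := hmax e hs
      omega
    have hac : ∀ y, m ≤ y → (a, y) ∈ rowFill S' m := fun y hy => Or.inr ⟨hy, m, le_rfl, ha⟩
    have hnew : ∀ u v, (u, v) ∈ rowFill S' m → (u, v) ∉ S' →
        (u = a ∧ m < v) ∨ (v = m ∧ a < u) := by
      intro u v hu hu'
      have hv : m ≤ v := by
        by_contra hcon
        exact hu' (hlow u v hu (by omega))
      rcases eq_or_lt_of_le hv with rfl | hv
      · right
        refine ⟨rfl, ?_⟩
        by_contra hcon
        rcases hu with ⟨hu, -⟩ | ⟨-, z, hz, hu⟩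
        · exact hu' hu
        · have := h'.min_mem hu ha
          rw [min_eq_left (by dsimp; omega), min_eq_right hz] at this
          exact hu' this
      · left
        have hum := (hfill u v hu (by omega)).resolve_left hu'
        refine ⟨le_antisymm (hmax u hum) ?_, hv⟩
        by_contra hcon
        obtain ⟨e, he, hs⟩ := h'.exists_above hum ha (by omega)
        exact hu' (h'.mem_column hs (by omega) (by omega))
    have hleft : ∀ u v, (u, v) ∈ rowFill S' m → u < a → (u, v) ∈ S' := by
      intro u v hu hlt
      by_contra hcon
      have := hnew u v hu hcon
      omega
    have hS' : ∀ u v, (u, v) ∈ S' → ¬ ((u = a ∧ m < v) ∨ (v = m ∧ a < u)) := by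
      rintro u v hu (⟨rfl, hv⟩ | ⟨rfl, hv⟩)
      · exact hcol v hv hu
      · have := hmax u hu
        omega
    have hIA1 : ((a : WithTop ℤ), (⊤ : WithTop ℤ)) ∈ IA (rowFill S' m) := by
      have : (a, (condE (rowFill S' m)).2) ∈ rowFill S' m :=
        h.mem_column (hac m le_rfl) hcle.2 le_rfl
      exact ⟨coe_top_mem_ISet h hl h' this
        (fun N => ⟨max N (m + 1), by omega, hcol _ (by omega)⟩) hleft,
        Or.inr (coe_top_mem_Sinf.2 this)⟩
    let α : ℕ → Om := fun i => if i = 0 then ((a : WithTop ℤ), ⊤) else (⊤, (m : WithTop ℤ))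
    have hup : upD (α 0 ⊓ α 1) = {s | (s.1 = a ∧ m < s.2) ∨ (s.2 = m ∧ a < s.1)} := by
      ext s
      simp [upD, α]
    have hT : trackSet (rowFill S' m) 2 α =
        rowFill S' m ∩ {s | (s.1 = a ∧ m < s.2) ∨ (s.2 = m ∧ a < s.1)} := by
      rw [← hup]
      ext s
      simp [trackSet, finPart, lowD1, lowD2, iotaZ, α, Prod.ext_iff]
    have hdata : TrackData (rowFill S' m) 2 α := by
      refine ⟨by norm_num, ?_, ?_, ?_, ?_, ?_⟩
      · intro i hi
        interval_cases i
        · exact hIA1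
        · exact hIA2
      · intro i j hij hj
        obtain ⟨rfl, rfl⟩ : i = 0 ∧ j = 1 := by omega
        simp [α]
      · simp [lowD2, α]
      · simp [lowD1, α]
      · intro i hi
        obtain rfl : i = 0 := by omega
        refine ⟨by simp [α, Prod.le_def], by simp [α, Prod.le_def], ?_⟩
        rw [zero_add, hup]
        rintro ⟨x, y⟩ hs hxy
        have hxy' : (x, y) ∉ S' := fun hh => hS' x y hh hxy
        refine iotaZ_mem_ISet h hl h' hs hxy' fun u v hu hux hvy => ?_
        by_contra hcon
        have := hnew u v hu hcon
        simp only [Set.mem_ofPred_eq] at hxy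
        omega
    refine ⟨_, inTS_of_top_coe (x := max (condE S').1 (a + 1)) hdata rfl ?_ ?_ ?_ rfl, ?_⟩
    · rw [hT]
      exact ⟨hbig _ _ (by omega) le_rfl, Or.inr ⟨rfl, by dsimp; omega⟩⟩
    · exact hbig _ _ (by omega) le_rfl
    · exact hcle.trans ⟨by dsimp; omega, le_rfl⟩
    · rw [hT]
      ext ⟨u, v⟩
      refine ⟨fun hu => ⟨hsub hu, fun hT => hS' u v hu hT.2⟩, fun hu => ?_⟩
      by_contra hcon
      exact hu.2 ⟨hu.1, hnew u v hu.1 hcon⟩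
  · push Not at hex
    have hnew : ∀ u v, (u, v) ∈ rowFill S' m → v ≠ m → (u, v) ∈ S' := by
      intro u v hu hv
      rcases lt_or_gt_of_ne hv with hv | hv
      · exact hlow u v hu hv
      · exact (hfill u v hu (by omega)).resolve_right (hex u)
    let α : ℕ → Om := fun _ => (⊤, (m : WithTop ℤ))
    have hT : trackSet (rowFill S' m) 1 α = rowFill S' m ∩ {s | s.2 = m} := by
      ext s
      simp [trackSet, finPart, lowD1, lowD2, iotaZ, α, Prod.ext_iff]
    have hdata : TrackData (rowFill S' m) 1 α := by
      refine ⟨le_rfl, fun i _ => hIA2, fun i j hij hj => by omega, ?_, ?_,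
        fun i hi => by omega⟩
      · rintro ⟨x, y⟩ hs hxy
        obtain rfl : y = m := by simpa [lowD2, α] using hxy
        exact iotaZ_mem_ISet h hl h' hs (hex x) fun u v hu _ hv => hlow u v hu hv
      · simp [lowD1, α]
    refine ⟨_, inTS_of_top_coe (x := (condE S').1) hdata rfl ?_ (hbig _ _ le_rfl le_rfl) hcle rfl,
      ?_⟩
    · rw [hT]
      exact ⟨hbig _ _ le_rfl le_rfl, rfl⟩
    · rw [hT]
      ext ⟨u, v⟩
      refine ⟨fun hu => ⟨hsub hu, ?_⟩, fun hu => hnew u v hu.1 fun hv => hu.2 ⟨hu.1, hv⟩⟩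
      rintro ⟨-, hv⟩
      obtain rfl : v = m := hv
      exact hex u hu

lemma exists_inTS_columnFill {S' : Set Z2} (h' : IsGood S') (hl' : IsLocal S')
    (hc1 : 2 ≤ (condE S').1) (hc2 : (condE S').2 = 1) :
    ∃ T, InTS (swapSet (rowFill (swapSet S') ((condE S').1 - 1))) T ∧
      S' = swapSet (rowFill (swapSet S') ((condE S').1 - 1)) \ T := by
  have hcol : ∀ y, ((condE S').1 - 1, y) ∉ S' := by
    intro y hy
    have hpos := hl'.pos h' hy (by simp [Prod.ext_iff]; omega)
    have := h'.swapSet.notMem_row (x := y) (by rw [condE_swapSet]; dsimp; omega)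
    rw [condE_swapSet] at this
    exact this hy
  have hfill := fun x y => mem_of_mem_rowFill h'.swapSet (x := y) (y := x)
  have hS'c := fun x y => mem_of_condE_le h' (x := x) (y := y)
  rw [condE_swapSet] at hfill
  simp only [Prod.snd_swap] at hfill
  rw [hc2] at hS'c
  obtain ⟨a, ha⟩ : ∃ a, a = (condE S').1 - 1 := ⟨_, rfl⟩
  have hca : (condE S').1 = a + 1 := by omega
  rw [hca] at hS'c
  rw [← ha] at hcol hfill ⊢
  have ha1 : 1 ≤ a := by omega
  have h := (isGood_rowFill h'.swapSet ha1).swapSet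
  have hl := (isLocal_rowFill h'.swapSet hl'.swapSet ha1).swapSet
  have hsub : S' ⊆ swapSet (rowFill (swapSet S') a) := fun s hs =>
    subset_rowFill (swapSet S') a hs
  have hbig : ∀ x y, a ≤ x → 1 ≤ y → (x, y) ∈ swapSet (rowFill (swapSet S') a) :=
    fun x y hx hy => Or.inr ⟨hx, a + 1, by omega, hS'c (a + 1) y le_rfl hy⟩
  have hnew : ∀ u v, (u, v) ∈ swapSet (rowFill (swapSet S') a) → u ≠ a → (u, v) ∈ S' := by
    intro u v hu hv
    rcases lt_or_gt_of_ne hv with hv | hv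
    · rcases hu with ⟨hu, -⟩ | ⟨hu, -⟩
      · exact hu
      · dsimp at hu; omega
    · exact (hfill u v hu (by omega)).resolve_right (hcol v)
  have hcle := condE_le h (δ := (a, 1)) fun y hy => hbig y.1 y.2 hy.1 hy.2
  have hcS : (condE (swapSet (rowFill (swapSet S') a))).2 = 1 :=
    le_antisymm hcle.2 (hl.one_le_condE_snd h)
  have hIA : ((a : WithTop ℤ), (⊤ : WithTop ℤ)) ∈ IA (swapSet (rowFill (swapSet S') a)) := by
    have : (a, (condE (swapSet (rowFill (swapSet S') a))).2) ∈
        swapSet (rowFill (swapSet S') a) := by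
      rw [hcS]
      exact hbig _ _ le_rfl le_rfl
    exact ⟨coe_top_mem_ISet h hl h' this (fun N => ⟨N, le_rfl, hcol N⟩)
      (fun u v hu hv => hnew u v hu (by omega)), Or.inr (coe_top_mem_Sinf.2 this)⟩
  let α : ℕ → Om := fun _ => ((a : WithTop ℤ), ⊤)
  have hT : trackSet (swapSet (rowFill (swapSet S') a)) 1 α =
      swapSet (rowFill (swapSet S') a) ∩ {s | s.1 = a} := by
    ext s
    simp [trackSet, finPart, lowD1, lowD2, iotaZ, α, Prod.ext_iff]
  have hdata : TrackData (swapSet (rowFill (swapSet S') a)) 1 α := by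
    refine ⟨le_rfl, fun i _ => hIA, fun i j hij hj => by omega, ?_, ?_, fun i hi => by omega⟩
    · simp [lowD2, α]
    · rintro ⟨x, y⟩ hs hxy
      obtain rfl : x = a := by simpa [lowD1, α] using hxy
      exact iotaZ_mem_ISet h hl h' hs (hcol y) fun u v hu hv _ => hnew u v hu (by omega)
  refine ⟨_, Or.inl ⟨hcS, ⟨1, α, hdata, rfl⟩, (a, 1), ?_, hbig _ _ le_rfl le_rfl, hcle⟩, ?_⟩
  · rw [hT]
    exact ⟨hbig _ _ le_rfl le_rfl, rfl⟩
  · rw [hT]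
    ext ⟨u, v⟩
    refine ⟨fun hu => ⟨hsub hu, ?_⟩, fun hu => hnew u v hu.1 fun hv => hu.2 ⟨hu.1, hv⟩⟩
    rintro ⟨-, hv⟩
    obtain rfl : u = a := hv
    exact hcol v hu

/-! ### Uniqueness -/

/-- If `S'` arises from `S` by removing the end of the row of height `b ≥ c₂`, and possibly
the part above that row of one column meeting it, then `S` is recovered by filling. -/
lemma eq_rowFill {S S' : Set Z2} (h : IsGood S) (h' : IsGood S') {b : ℤ} (hb : (condE S).2 ≤ b)
    (hsub : S' ⊆ S) (hlow : ∀ u v, (u, v) ∈ S → v < b → (u, v) ∈ S')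
    (hrow : ∃ N, ∀ x, N ≤ x → (x, b) ∉ S')
    (hup : ∃ N, ∀ x y, N ≤ x → b < y → (x, y) ∈ S → (x, y) ∈ S')
    (hcol : ∀ x, (x, b) ∈ S → ∃ y, b ≤ y ∧ (x, y) ∈ S') :
    (condE S').2 = b + 1 ∧ S = rowFill S' b := by
  constructor
  · obtain ⟨N, hN⟩ := hrow
    obtain ⟨M, hM⟩ := hup
    apply le_antisymm
    · refine (condE_le h' (δ := (max (condE S).1 M, b + 1)) ?_).2
      rintro ⟨x, y⟩ ⟨hx, hy⟩
      dsimp at hx hy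
      exact hM x y (by omega) (by omega) (mem_of_condE_le h (by omega) (by omega))
    · by_contra hcon
      exact hN _ (le_max_left N (condE S').1)
        (mem_of_condE_le h' (le_max_right _ _) (by omega))
  · ext ⟨u, v⟩
    constructor
    · intro hu
      rcases lt_or_ge v b with hv | hv
      · exact Or.inl ⟨hlow u v hu hv, hv⟩
      · exact Or.inr ⟨hv, hcol u (h.mem_column hu (by omega) hb)⟩
    · rintro (⟨hu, -⟩ | ⟨hv, z, hz, hu⟩)
      · exact hsub hu
      · dsimp at hv
        exact h.mem_column (hsub hu) (by omega) (by omega)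

/-- Second coordinates of consecutive points of a track decrease. -/
lemma Piece.snd_lt {S : Set Z2} {a b : Om} (hp : Piece S a b) (hlt : a.1 < b.1) : b.2 < a.2 := by
  by_contra hcon
  exact hp.1 ⟨hlt.le, not_lt.1 hcon⟩

/-- An element of height at least `c₂` is not a finite maximal. -/
lemma notMem_Af {S : Set Z2} (h : IsGood S) {x y : ℤ} (hy : (condE S).2 ≤ y) :
    (x, y) ∉ Af S := by
  rintro ⟨-, h2⟩
  have : (max (x + 1) (condE S).1, y) ∈ S ∩ DeltaUp (x, y) :=
    ⟨mem_of_condE_le h (by omega) hy, Or.inr ⟨rfl, by dsimp; omega⟩⟩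
  rw [h2] at this
  exact this

/-- An irreducible maximal whose second coordinate exceeds some `b ≥ c₂` is of the
form `(a, ∞)`. -/
lemma eq_coe_top_of_mem_IA {S : Set Z2} (h : IsGood S) {w : Om} (hw : w ∈ IA S) {b : ℤ}
    (hb : (condE S).2 ≤ b) (h1 : w.1 < ⊤) (hlt : (b : WithTop ℤ) < w.2) :
    ∃ a : ℤ, w = ((a : WithTop ℤ), ⊤) ∧ (a, (condE S).2) ∈ S := by
  rcases hw.2 with ⟨⟨x, y⟩, hs, rfl⟩ | ⟨a, rfl, ha⟩ | ⟨y, rfl, -⟩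
  · have : b < y := by simpa [iotaZ] using hlt
    exact absurd hs (notMem_Af h (by omega))
  · exact ⟨a, rfl, ha⟩
  · simp at h1

lemma eq_rowFill_of_track {S S' : Set Z2} (h : IsGood S) (h' : IsGood S') {n : ℕ} {α : ℕ → Om}
    (hα : TrackData S n α) (hS' : S' = S \ trackSet S n α) {b : ℤ} (hb : (condE S).2 ≤ b)
    (hend : α (n - 1) = ((⊤ : WithTop ℤ), (b : WithTop ℤ))) :
    (condE S').2 = b + 1 ∧ S = rowFill S' b := by
  obtain ⟨hn, hIA, hinc, -, -, hpiece⟩ := hα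
  have hn2 : n = 1 ∨ n = 2 := by
    by_contra hcon
    have hlt1 := hinc (n - 2) (n - 1) (by omega) (by omega)
    have hp1 := hpiece (n - 2) (by omega)
    rw [show n - 2 + 1 = n - 1 by omega] at hp1
    have hlt2 := hp1.snd_lt hlt1
    have hlt3 := hinc (n - 3) (n - 2) (by omega) (by omega)
    have hp2 := hpiece (n - 3) (by omega)
    rw [show n - 3 + 1 = n - 2 by omega] at hp2
    have hlt4 := hp2.snd_lt hlt3
    rw [hend] at hlt1 hlt2
    obtain ⟨a, ha, -⟩ := eq_coe_top_of_mem_IA h (hIA (n - 2) (by omega)) hb hlt1 hlt2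
    rw [ha] at hlt4
    simp at hlt4
  rcases hn2 with rfl | rfl
  · have hT : trackSet S 1 α = S ∩ {s | s.2 = b} := by
      ext s
      simp only [Nat.sub_self] at hend
      simp [trackSet, finPart, lowD1, lowD2, iotaZ, hend, Prod.ext_iff]
    have hmem : ∀ u v, (u, v) ∈ S' ↔ (u, v) ∈ S ∧ v ≠ b := by
      intro u v
      rw [hS', hT]
      simp +contextual
    refine eq_rowFill h h' hb (fun s hs => ((hmem _ _).1 hs).1) ?_ ?_ ?_ ?_
    · exact fun u v hu hv => (hmem _ _).2 ⟨hu, by omega⟩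
    · exact ⟨0, fun x _ hx => ((hmem _ _).1 hx).2 rfl⟩
    · exact ⟨0, fun x y _ hy hx => (hmem _ _).2 ⟨hx, by omega⟩⟩
    · exact fun x hx => ⟨b + 1, by omega,
        (hmem _ _).2 ⟨h.mem_column hx hb (by omega), by omega⟩⟩
  · have hlt1 := hinc 0 1 (by omega) (by omega)
    have hlt2 := (hpiece 0 (by omega)).snd_lt hlt1
    rw [show 2 - 1 = 1 from rfl] at hend
    rw [zero_add] at hlt2
    rw [hend] at hlt1 hlt2
    obtain ⟨a, ha, haS⟩ := eq_coe_top_of_mem_IA h (hIA 0 (by omega)) hb hlt1 hlt2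
    have hT : trackSet S 2 α = S ∩ {s | (s.1 = a ∧ b < s.2) ∨ (s.2 = b ∧ a < s.1)} := by
      ext s
      simp [trackSet, finPart, lowD1, lowD2, upD, iotaZ, hend, ha, Prod.ext_iff]
    have hmem : ∀ u v, (u, v) ∈ S' ↔
        (u, v) ∈ S ∧ ¬ ((u = a ∧ b < v) ∨ (v = b ∧ a < u)) := by
      intro u v
      rw [hS', hT]
      simp +contextual
    refine eq_rowFill h h' hb (fun s hs => ((hmem _ _).1 hs).1) ?_ ?_ ?_ ?_
    · exact fun u v hu hv => (hmem _ _).2 ⟨hu, by omega⟩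
    · exact ⟨a + 1, fun x hx hs => ((hmem _ _).1 hs).2 (Or.inr ⟨rfl, by omega⟩)⟩
    · exact ⟨a + 1, fun x y hx hy hs => (hmem _ _).2 ⟨hs, by omega⟩⟩
    · intro x hx
      by_cases hxa : x = a
      · exact ⟨b, le_rfl, (hmem _ _).2 ⟨hx, by omega⟩⟩
      · exact ⟨b + 1, by omega, (hmem _ _).2 ⟨h.mem_column hx hb (by omega), by omega⟩⟩

lemma eq_columnFill_of_track {S S' : Set Z2} (h : IsGood S) (h' : IsGood S') (hl' : IsLocal S')
    {n : ℕ} {α : ℕ → Om} (hα : TrackData S n α) (hS' : S' = S \ trackSet S n α)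
    (hc2 : (condE S).2 = 1) (hbeyond : (trackSet S n α ∩ {s ∈ S | condE S ≤ s}).Nonempty) {a : ℤ}
    (hend : α (n - 1) = ((a : WithTop ℤ), (⊤ : WithTop ℤ))) :
    (condE S').2 = 1 ∧ S = swapSet (rowFill (swapSet S') ((condE S').1 - 1)) := by
  obtain ⟨hn, hIA, hinc, -, -, hpiece⟩ := hα
  obtain rfl : n = 1 := by
    by_contra hcon
    have hlt1 := hinc (n - 2) (n - 1) (by omega) (by omega)
    have hp1 := hpiece (n - 2) (by omega)
    rw [show n - 2 + 1 = n - 1 by omega] at hp1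
    have hlt2 := hp1.snd_lt hlt1
    rw [hend] at hlt2
    simp at hlt2
  have hT : trackSet S 1 α = S ∩ {s | s.1 = a} := by
    ext s
    simp only [Nat.sub_self] at hend
    simp [trackSet, finPart, lowD1, lowD2, iotaZ, hend, Prod.ext_iff]
  have hmem : ∀ u v, (u, v) ∈ S' ↔ (u, v) ∈ S ∧ u ≠ a := by
    intro u v
    rw [hS', hT]
    simp +contextual
  have hca : (condE S).1 ≤ a := by
    obtain ⟨s, hs, -, hcs⟩ := hbeyond
    rw [hT] at hs
    have := hcs.1
    rwa [show s.1 = a from hs.2] at this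
  have key := eq_rowFill h.swapSet h'.swapSet (b := a) (by rwa [condE_swapSet])
    (fun s hs => ((hmem _ _).1 hs).1) (fun u v hu hv => (hmem _ _).2 ⟨hu, by omega⟩)
    ⟨0, fun x _ hx => ((hmem _ _).1 hx).2 rfl⟩
    ⟨0, fun x y _ hy hx => (hmem _ _).2 ⟨hx, by omega⟩⟩
    (fun x hx => ⟨a + 1, by omega, (hmem _ _).2
      ⟨h.mem_row hx hca (by omega), by omega⟩⟩)
  rw [condE_swapSet] at key
  obtain ⟨k1, k2⟩ := key
  rw [Prod.snd_swap] at k1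
  refine ⟨le_antisymm (condE_le h' (δ := (a + 1, 1)) ?_).2 (hl'.one_le_condE_snd h'), ?_⟩
  · rintro ⟨x, y⟩ ⟨hx, hy⟩
    dsimp at hx hy
    exact (hmem _ _).2 ⟨mem_of_condE_le h (by omega) (by omega), by omega⟩
  · rw [k1, add_sub_cancel_right, ← k2, swapSet_swapSet]

lemma eq_fill_of_inTS {S S' T : Set Z2} (h : IsGood S) (hl : IsLocal S) (h' : IsGood S')
    (hl' : IsLocal S') (hT : InTS S T) (hS' : S' = S \ T) :
    (2 ≤ (condE S').2 ∧ S = rowFill S' ((condE S').2 - 1)) ∨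
    ((condE S').2 = 1 ∧ S = swapSet (rowFill (swapSet S') ((condE S').1 - 1))) := by
  have hc2 := hl.one_le_condE_snd h
  have hc1 := hl.one_le_condE_fst h
  have row : ∀ (n : ℕ) (α : ℕ → Om) (b : ℤ), TrackData S n α → T = trackSet S n α →
      (condE S).2 ≤ b → α (n - 1) = ((⊤ : WithTop ℤ), (b : WithTop ℤ)) →
      2 ≤ (condE S').2 ∧ S = rowFill S' ((condE S').2 - 1) := by
    rintro n α b hα rfl hb hend
    obtain ⟨k1, k2⟩ := eq_rowFill_of_track h h' hα hS' hb hend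
    exact ⟨by omega, by rwa [k1, add_sub_cancel_right]⟩
  rcases hT with ⟨hc, ⟨n, α, hα, rfl⟩, hbeyond⟩ | ⟨-, n, α, hα, rfl, -, hend⟩
  · have hIA := hα.2.1 (n - 1) (by have := hα.1; omega)
    rcases hIA.2 with ⟨⟨x, y⟩, hs, heq⟩ | ⟨a, ha, -⟩ | ⟨b, hb, hbS⟩
    · exfalso
      by_cases h0 : (x, y) = (0 : Z2)
      · apply hIA.1.2.1
        rw [← heq, h0]
        rfl
      · have := (hl.pos h hs.1 h0).2
        exact notMem_Af h (by omega) hs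
    · exact Or.inr (eq_columnFill_of_track h h' hl' hα hS' hc hbeyond ha)
    · have := (hl.pos h hbS (by simp [Prod.ext_iff]; omega)).2
      exact Or.inl (row n α b hα rfl (by omega) hb)
  · have hIA := hα.2.1 (n - 1) (by have := hα.1; omega)
    rcases hIA.2 with ⟨s, -, heq⟩ | ⟨a, ha, -⟩ | ⟨b, hb, -⟩
    · rw [← heq] at hend
      simpa [iotaZ] using hend.1
    · rw [ha] at hend
      simpa using hend.1
    · rw [hb] at hend
      exact Or.inl (row n α b hα rfl (by simpa using hend.2) hb)

/-- Every local good semigroup `S' ≠ ℕ²(1,1)` of `ℕ²` has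
one and only one special parent `S` with `S' = S∖T` for some `T ∈ T(S)`. -/
theorem existsUnique_specialParent_in_TS (S' : Set Z2) (hS' : IsGood S')
    (hl' : IsLocal S') (hne : S' ≠ N2oneone) :
    ∃! S : Set Z2, IsGood S ∧ IsLocal S ∧
      ∃ T : Set Z2, InTS S T ∧ S' = S \ T := by
  have hc2 := hl'.one_le_condE_snd hS'
  by_cases hc : (condE S').2 = 1
  · have hc1 : 2 ≤ (condE S').1 := by
      by_contra hcon
      apply hne
      ext ⟨x, y⟩
      constructor
      · intro hs
        by_cases h0 : (x, y) = (0 : Z2)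
        · exact Or.inl h0
        · exact Or.inr (hl'.pos hS' hs h0)
      · rintro (h0 | ⟨hx, hy⟩)
        · rw [h0]
          exact hS'.2.1
        · dsimp at hx hy
          exact mem_of_condE_le hS' (by omega) (by omega)
    refine ⟨swapSet (rowFill (swapSet S') ((condE S').1 - 1)),
      ⟨(isGood_rowFill hS'.swapSet (by omega)).swapSet,
        (isLocal_rowFill hS'.swapSet hl'.swapSet (by omega)).swapSet,
        exists_inTS_columnFill hS' hl' hc1 hc⟩, ?_⟩
    rintro S ⟨h, hl, T, hT, hST⟩
    rcases eq_fill_of_inTS h hl hS' hl' hT hST with ⟨h2, -⟩ | ⟨-, h2⟩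
    · omega
    · exact h2
  · refine ⟨rowFill S' ((condE S').2 - 1), ⟨isGood_rowFill hS' (by omega),
      isLocal_rowFill hS' hl' (by omega), exists_inTS_rowFill hS' hl' (by omega)⟩, ?_⟩
    rintro S ⟨h, hl, T, hT, hST⟩
    rcases eq_fill_of_inTS h hl hS' hl' hT hST with ⟨-, h2⟩ | ⟨h2, -⟩
    · exact h2
    · omega
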